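/- Let R be a commutative ring, n : ℕ, h : MvPolynomial (Fin n) R, and i, j : Fin n with i ≠ j. Let D : ℕ with D > degreeOf j h and let ψ = ψ_{i→j,D}. Then for every exponent vector v : Fin n →₀ ℕ with v j ≤ degreeOf j h, the coefficient of h at v equals the coefficient of ψ h at the vector v' defined by v' i = 0, v' j = v i * D + v j, and v' m = v m for all m ∉ {i, j}. Consequently h can be recovered from ψ h by replacing each exponent K of X j by the pair (K mod D on X j, K div D on X i). -/

import Mathlib

open MvPolynomial

/-- Single Kronecker substitution: sends `X i` to `(X j) ^ D` and fixes every other variable. -/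
noncomputable def singleKron (R : Type*) [CommRing R] {n : ℕ} (i j : Fin n) (D : ℕ) :
    MvPolynomial (Fin n) R →ₐ[R] MvPolynomial (Fin n) R :=
  MvPolynomial.aeval (fun m : Fin n =>
    if m = i then (MvPolynomial.X j : MvPolynomial (Fin n) R) ^ D else MvPolynomial.X m)

/-- The exponent vector of the image of the monomial with exponent `u` under the substitution
`X i ↦ (X j) ^ D`. -/
noncomputable def kronExponent {n : ℕ} (i j : Fin n) (D : ℕ) (u : Fin n →₀ ℕ) : Fin n →₀ ℕ :=
  Finsupp.equivFunOnFinite.symm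
    (fun m : Fin n => if m = i then 0 else if m = j then u i * D + u j else u m)

theorem kronExponent_apply {n : ℕ} (i j : Fin n) (D : ℕ) (u : Fin n →₀ ℕ) (m : Fin n) :
    kronExponent i j D u m = if m = i then 0 else if m = j then u i * D + u j else u m :=
  rfl

theorem kronExponent_eq_sum {n : ℕ} {i j : Fin n} (hij : i ≠ j) (D : ℕ) (u : Fin n →₀ ℕ) :
    kronExponent i j D u =
      ∑ k, u k • (if k = i then Finsupp.single j D else Finsupp.single k 1) := by
  ext m
  have key : ∀ k ∈ Finset.univ.erase i,
      (u k • (if k = i then Finsupp.single j D else Finsupp.single k 1)) m =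
        if k = m then u k else 0 := by
    intro k hk
    simp [Finset.ne_of_mem_erase hk, Finsupp.single_apply]
  rw [kronExponent_apply, Finsupp.finsetSum_apply,
    ← Finset.add_sum_erase _ _ (Finset.mem_univ i), Finset.sum_congr rfl key,
    Finset.sum_ite_eq']
  by_cases hmi : m = i
  · subst hmi
    simp [hij.symm]
  · by_cases hmj : m = j
    · subst hmj
      simp [hmi]
    · simp [hmi, hmj]

theorem kronExponent_injOn {n : ℕ} {i j : Fin n} (hij : i ≠ j) (D : ℕ) :
    Set.InjOn (kronExponent i j D) {u | u j < D} := by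
  intro u hu v hv huv
  simp only [Set.mem_ofPred_eq] at hu hv
  have hD : 0 < D := by omega
  have hval (m : Fin n) := DFunLike.congr_fun huv m
  simp only [kronExponent_apply] at hval
  have hj : u i * D + u j = v i * D + v j := by simpa [hij.symm] using hval j
  have hjmod := congrArg (· % D) hj
  have hidiv := congrArg (· / D) hj
  simp only [Nat.mul_add_mod_of_lt, hu, hv] at hjmod
  simp only [Nat.mul_comm _ D, Nat.mul_add_div hD, Nat.div_eq_of_lt hu, Nat.div_eq_of_lt hv,
    add_zero] at hidiv
  ext m
  by_cases hmi : m = i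
  · rw [hmi, hidiv]
  · by_cases hmj : m = j
    · rw [hmj, hjmod]
    · simpa [hmi, hmj] using hval m

theorem singleKron_monomial {R : Type*} [CommRing R] {n : ℕ} {i j : Fin n} (hij : i ≠ j) (D : ℕ)
    (u : Fin n →₀ ℕ) (a : R) :
    singleKron R i j D (monomial u a) = monomial (kronExponent i j D u) a := by
  have hvar : ∀ k : Fin n,
      (if k = i then (X j : MvPolynomial (Fin n) R) ^ D else X k) =
        monomial (if k = i then Finsupp.single j D else Finsupp.single k 1) 1 := by
    intro k
    split_ifs
    · exact X_pow_eq_monomial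
    · rfl
  rw [singleKron, aeval_monomial, Finsupp.prod_fintype _ _ (fun _ => pow_zero _)]
  simp only [hvar, monomial_pow, one_pow]
  rw [← monomial_sum_one, ← kronExponent_eq_sum hij, algebraMap_eq, C_mul_monomial, mul_one]

theorem stmt_9 {R : Type*} [CommRing R] {n : ℕ} (h : MvPolynomial (Fin n) R)
    (i j : Fin n) (hij : i ≠ j) (D : ℕ) (hD : h.degreeOf j < D)
    (v : Fin n →₀ ℕ) (hv : v j ≤ h.degreeOf j) :
    MvPolynomial.coeff v h =
      MvPolynomial.coeff
        (Finsupp.equivFunOnFinite.symm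
          (fun m : Fin n => if m = i then 0 else if m = j then v i * D + v j else v m))
        (singleKron R i j D h) := by
  change _ = coeff (kronExponent i j D v) (singleKron R i j D h)
  have hlt : ∀ u ∈ h.support, u j < D := fun u hu =>
    (monomial_le_degreeOf j hu).trans_lt hD
  have himage : singleKron R i j D h =
      ∑ u ∈ h.support, monomial (kronExponent i j D u) (coeff u h) := by
    conv_lhs => rw [h.as_sum]
    simp only [map_sum, singleKron_monomial hij]
  conv_lhs => rw [h.as_sum]
  rw [himage, coeff_sum, coeff_sum]
  refine Finset.sum_congr rfl fun u hu => ?_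
  simp only [coeff_monomial,
    (kronExponent_injOn hij D).eq_iff (hlt u hu) (hv.trans_lt hD)]
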